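/- arXiv:2305.11356 — 2 statements merged into one kernel-verified Lean document; each statement's English description precedes it below -/
import Mathlib

section
/- The space P₁(R^d; S) of symmetric-matrix-valued polynomials of degree at most 1 decomposes as the direct sum of ∇²P₃(R^d) (Hessians of cubic polynomials) and the kernel of the map τ ↦ x^T τ(x) x restricted to P₁(R^d; S). Consequently the dimension of this kernel equals 2·C(d+1,3). -/
open MvPolynomial Matrix

/-- Matrix-valued fields on `ℝ^d`. -/
abbrev MatField (d : ℕ) := (Fin d → ℝ) → Matrix (Fin d) (Fin d) ℝ

/-- `P₁(ℝ^d; S)`: symmetric-matrix-valued polynomials of degree at most 1. -/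
def P1Sym (d : ℕ) : Set (MatField d) :=
  {τ | (∀ x, (τ x).IsSymm) ∧
    ∃ (A : Matrix (Fin d) (Fin d) ℝ) (B : Fin d → Matrix (Fin d) (Fin d) ℝ),
      ∀ x, τ x = A + ∑ i : Fin d, x i • B i}

/-- The kernel of `τ ↦ (x ↦ xᵀ τ(x) x)` inside `P₁(ℝ^d; S)`. -/
def kerXTX (d : ℕ) : Set (MatField d) :=
  {τ | τ ∈ P1Sym d ∧ ∀ x, x ⬝ᵥ (τ x).mulVec x = 0}

/-- The Hessian of a polynomial, as a matrix-valued field. -/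
noncomputable def hessField (d : ℕ) (q : MvPolynomial (Fin d) ℝ) : MatField d :=
  fun x => Matrix.of fun i j => eval x (pderiv i (pderiv j q))

/-- The tensors `B` symmetric in the last two indices whose cyclic sums vanish. -/
def cyclicKer (d : ℕ) : Submodule ℝ (Fin d → Fin d → Fin d → ℝ) where
  carrier := {B | (∀ i j k, B i j k = B i k j) ∧ ∀ i j k, B i j k + B j k i + B k i j = 0}
  add_mem' := by
    rintro B C ⟨hB, hB'⟩ ⟨hC, hC'⟩
    refine ⟨fun i j k => ?_, fun i j k => ?_⟩
    · simp only [Pi.add_apply, hB i j k, hC i j k]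
    · simp only [Pi.add_apply]
      linarith [hB' i j k, hC' i j k]
  zero_mem' := by simp
  smul_mem' := by
    rintro c B ⟨hB, hB'⟩
    refine ⟨fun i j k => ?_, fun i j k => ?_⟩
    · simp only [Pi.smul_apply, hB i j k]
    · simp only [Pi.smul_apply, smul_eq_mul]
      rw [← mul_add, ← mul_add, hB', mul_zero]

/-- The linear matrix field `x ↦ ∑ i, x i • B i` attached to a tensor `B`. -/
def linearField (d : ℕ) : (Fin d → Fin d → Fin d → ℝ) →ₗ[ℝ] MatField d where
  toFun B := fun x => Matrix.of fun j k => ∑ i, x i * B i j k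
  map_add' B C := by
    ext x j k
    simp [mul_add, Finset.sum_add_distrib]
  map_smul' c B := by
    ext x j k
    simp [Finset.mul_sum, mul_left_comm]

lemma linearField_apply {d : ℕ} (B : Fin d → Fin d → Fin d → ℝ) (x : Fin d → ℝ) (j k : Fin d) :
    linearField d B x j k = ∑ i, x i * B i j k := rfl

lemma linearField_single {d : ℕ} (B : Fin d → Fin d → Fin d → ℝ) (i j k : Fin d) :
    linearField d B (Pi.single i 1) j k = B i j k := by
  simp [linearField_apply, Pi.single_apply]

lemma linearField_zero {d : ℕ} (B : Fin d → Fin d → Fin d → ℝ) (j k : Fin d) :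
    linearField d B 0 j k = 0 := by
  simp [linearField_apply]

lemma linearField_injective (d : ℕ) : Function.Injective (linearField d) := by
  intro B C h
  ext i j k
  rw [← linearField_single B, h, linearField_single]

lemma mem_P1Sym_iff {d : ℕ} {τ : MatField d} :
    τ ∈ P1Sym d ↔ ∃ (A : Fin d → Fin d → ℝ) (B : Fin d → Fin d → Fin d → ℝ),
      (∀ j k, A j k = A k j) ∧ (∀ i j k, B i j k = B i k j) ∧
      ∀ x j k, τ x j k = A j k + linearField d B x j k := by
  constructor
  · rintro ⟨hs, A, B, h⟩
    obtain ⟨A, B, h'⟩ : ∃ (A : Fin d → Fin d → ℝ) (B : Fin d → Fin d → Fin d → ℝ),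
        ∀ x j k, τ x j k = A j k + linearField d B x j k :=
      ⟨fun j k => A j k, fun i j k => B i j k, fun x j k => by
        simp [h, linearField_apply, Matrix.sum_apply]⟩
    have hA : ∀ j k, A j k = A k j := fun j k => by
      simpa [h', linearField_zero] using (hs 0).apply k j
    refine ⟨A, B, hA, fun i j k => ?_, h'⟩
    have := (hs (Pi.single i 1)).apply k j
    rwa [h', h', linearField_single, linearField_single, hA k j, add_right_inj] at this
  · rintro ⟨A, B, hA, hB, h⟩
    refine ⟨fun x => Matrix.IsSymm.ext fun j k => ?_, Matrix.of A, fun i => Matrix.of (B i),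
      fun x => ?_⟩
    · simp only [h, linearField_apply, hA k j, hB _ k j]
    · ext j k
      simp [h, linearField_apply, Matrix.sum_apply]

lemma eq_zero_of_forall_quadratic_eq_zero {d : ℕ} {A : Fin d → Fin d → ℝ}
    (hA : ∀ j k, A j k = A k j) (h : ∀ x : Fin d → ℝ, ∑ j, ∑ k, x j * x k * A j k = 0)
    (j k : Fin d) : A j k = 0 := by
  let T : (Fin d → ℝ) → (Fin d → ℝ) → ℝ := fun x y => ∑ j, ∑ k, x j * y k * A j k
  have h' : ∀ x, T x x = 0 := h
  have add_left : ∀ x x' y, T (x + x') y = T x y + T x' y := fun x x' y => by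
    simp [T, add_mul, Finset.sum_add_distrib]
  have add_right : ∀ x y y', T x (y + y') = T x y + T x y' := fun x y y' => by
    simp [T, add_mul, mul_add, Finset.sum_add_distrib]
  have single : ∀ j k, T (Pi.single j 1) (Pi.single k 1) = A j k := fun j k => by
    simp [T, Pi.single_apply]
  have hjk := h' (Pi.single j 1 + Pi.single k 1)
  simp only [add_left, add_right, h', single] at hjk
  linarith [hA j k]

lemma cyclic_sum_eq_zero_of_forall_cubic_eq_zero {d : ℕ} {B : Fin d → Fin d → Fin d → ℝ}
    (hB : ∀ i j k, B i j k = B i k j)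
    (h : ∀ x : Fin d → ℝ, ∑ i, ∑ j, ∑ k, x i * x j * x k * B i j k = 0)
    (i j k : Fin d) : B i j k + B j k i + B k i j = 0 := by
  let T : (Fin d → ℝ) → (Fin d → ℝ) → (Fin d → ℝ) → ℝ :=
    fun x y z => ∑ i, ∑ j, ∑ k, x i * y j * z k * B i j k
  have h' : ∀ x, T x x x = 0 := h
  have add₁ : ∀ x x' y z, T (x + x') y z = T x y z + T x' y z := fun x x' y z => by
    simp [T, add_mul, Finset.sum_add_distrib]
  have add₂ : ∀ x y y' z, T x (y + y') z = T x y z + T x y' z := fun x y y' z => by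
    simp [T, add_mul, mul_add, Finset.sum_add_distrib]
  have add₃ : ∀ x y z z', T x y (z + z') = T x y z + T x y z' := fun x y z z' => by
    simp [T, add_mul, mul_add, Finset.sum_add_distrib]
  have single : ∀ i j k, T (Pi.single i 1) (Pi.single j 1) (Pi.single k 1) = B i j k :=
    fun i j k => by simp [T, Pi.single_apply]
  have hijk := h' (Pi.single i 1 + Pi.single j 1 + Pi.single k 1)
  have hij := h' (Pi.single i 1 + Pi.single j 1)
  have hjk := h' (Pi.single j 1 + Pi.single k 1)
  have hik := h' (Pi.single i 1 + Pi.single k 1)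
  have hi := h' (Pi.single i 1)
  have hj := h' (Pi.single j 1)
  have hk := h' (Pi.single k 1)
  simp only [add₁, add₂, add₃, single] at hijk hij hjk hik hi hj hk
  linarith [hB i j k, hB j k i, hB k i j]

lemma dotProduct_mulVec_linearField {d : ℕ} (B : Fin d → Fin d → Fin d → ℝ) (x : Fin d → ℝ) :
    x ⬝ᵥ (linearField d B x).mulVec x = ∑ i, ∑ j, ∑ k, x i * x j * x k * B i j k := by
  simp only [dotProduct, mulVec, linearField_apply, Finset.mul_sum, Finset.sum_mul]
  rw [Finset.sum_comm_cycle]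
  refine Finset.sum_congr rfl fun i _ => ?_
  refine Finset.sum_congr rfl fun j _ => Finset.sum_congr rfl fun k _ => by ring

lemma kerXTX_eq_map (d : ℕ) :
    kerXTX d = ((cyclicKer d).map (linearField d) : Submodule ℝ (MatField d)) := by
  ext τ
  simp only [SetLike.mem_coe, Submodule.mem_map]
  constructor
  · rintro ⟨hτ, h⟩
    obtain ⟨A, B, hA, hB, hAB⟩ := mem_P1Sym_iff.1 hτ
    have hsplit : ∀ x, τ x = Matrix.of A + linearField d B x := fun x => by
      ext j k
      simp [hAB]
    have hform : ∀ x : Fin d → ℝ, ∑ j, ∑ k, x j * x k * A j k +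
        ∑ i, ∑ j, ∑ k, x i * x j * x k * B i j k = 0 := fun x => by
      rw [← h x, hsplit, Matrix.add_mulVec, dotProduct_add, dotProduct_mulVec_linearField]
      congr 1
      simp only [dotProduct, mulVec, Finset.mul_sum, Matrix.of_apply]
      exact Finset.sum_congr rfl fun j _ => Finset.sum_congr rfl fun k _ => by ring
    have hneg : ∀ x : Fin d → ℝ, ∑ j, ∑ k, x j * x k * A j k -
        ∑ i, ∑ j, ∑ k, x i * x j * x k * B i j k = 0 := fun x => by
      simpa [sub_eq_add_neg] using hform (-x)
    have hA0 := eq_zero_of_forall_quadratic_eq_zero hA fun x => by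
      linarith [hform x, hneg x]
    have hB0 := cyclic_sum_eq_zero_of_forall_cubic_eq_zero hB fun x => by
      linarith [hform x, hneg x]
    refine ⟨B, ⟨hB, hB0⟩, ?_⟩
    ext x j k
    rw [hAB, hA0, zero_add]
  · rintro ⟨B, ⟨hB, hB0⟩, rfl⟩
    refine ⟨mem_P1Sym_iff.2 ⟨0, B, by simp, hB, by simp⟩, fun x => ?_⟩
    rw [dotProduct_mulVec_linearField]
    have h₁ : ∑ i, ∑ j, ∑ k, x i * x j * x k * B i j k =
        ∑ i, ∑ j, ∑ k, x i * x j * x k * B j k i := by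
      rw [Finset.sum_comm_cycle]
      refine Finset.sum_congr rfl fun i _ => ?_
      refine Finset.sum_congr rfl fun j _ => Finset.sum_congr rfl fun k _ => by ring
    have h₂ : ∑ i, ∑ j, ∑ k, x i * x j * x k * B i j k =
        ∑ i, ∑ j, ∑ k, x i * x j * x k * B k i j := by
      rw [← Finset.sum_comm_cycle]
      refine Finset.sum_congr rfl fun i _ => ?_
      refine Finset.sum_congr rfl fun j _ => Finset.sum_congr rfl fun k _ => by ring
    have h₃ : ∑ i, ∑ j, ∑ k, x i * x j * x k * B i j k +
        ∑ i, ∑ j, ∑ k, x i * x j * x k * B j k i +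
        ∑ i, ∑ j, ∑ k, x i * x j * x k * B k i j = 0 := by
      simp only [← Finset.sum_add_distrib, ← mul_add, hB0, mul_zero, Finset.sum_const_zero]
    linarith

lemma MvPolynomial.eval_eq_of_totalDegree_le_one {d : ℕ} {p : MvPolynomial (Fin d) ℝ}
    (hp : p.totalDegree ≤ 1) (x : Fin d → ℝ) :
    eval x p = eval 0 p + ∑ i, x i * eval 0 (pderiv i p) := by
  have hmon : ∀ m ∈ p.support, ∀ c : ℝ, eval x (monomial m c) =
      eval 0 (monomial m c) + ∑ i, x i * eval 0 (pderiv i (monomial m c)) := by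
    intro m hm c
    have hm1 : m.degree ≤ 1 := (le_totalDegree hm).trans hp
    rcases Nat.le_one_iff_eq_zero_or_eq_one.1 hm1 with h | h
    · rw [Finsupp.degree_eq_zero_iff] at h
      subst h
      simp
    · obtain ⟨i, rfl⟩ := (Finsupp.sum_eq_one_iff m).1 h
      have : monomial (Finsupp.single i 1) c = C c * (X i : MvPolynomial (Fin d) ℝ) := by
        rw [C_mul_X_eq_monomial]
      rw [this]
      simp [pderiv_X, Pi.single_apply, mul_comm, apply_ite]
  rw [p.as_sum]
  simp only [map_sum, Finset.mul_sum]
  rw [Finset.sum_comm, ← Finset.sum_add_distrib]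
  exact Finset.sum_congr rfl fun m hm => by rw [hmon m hm]

lemma MvPolynomial.totalDegree_pderiv_le {d : ℕ} (p : MvPolynomial (Fin d) ℝ) (i : Fin d) :
    (pderiv i p).totalDegree ≤ p.totalDegree - 1 := by
  nth_rw 1 [p.as_sum]
  rw [map_sum]
  refine totalDegree_finsetSum_le fun m hm => ?_
  rw [pderiv_monomial]
  rcases Nat.eq_zero_or_pos (m i) with h | h
  · simp [h]
  · refine (totalDegree_monomial_le _ _).trans ?_
    have hle : Finsupp.single i 1 ≤ m := by simpa [Nat.one_le_iff_ne_zero] using h.ne'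
    have hdeg : (m - Finsupp.single i 1).degree + 1 = m.degree := by
      conv_rhs => rw [← tsub_add_cancel_of_le hle, map_add, Finsupp.degree_single]
    have hmp : m.degree ≤ p.totalDegree := le_totalDegree hm
    change (m - Finsupp.single i 1).degree ≤ _
    omega

lemma hessField_eq_of_totalDegree_le_three {d : ℕ} {q : MvPolynomial (Fin d) ℝ}
    (hq : q.totalDegree ≤ 3) (x : Fin d → ℝ) (j k : Fin d) :
    hessField d q x j k = hessField d q 0 j k +
      linearField d (fun i j k => eval 0 (pderiv i (pderiv j (pderiv k q)))) x j k := by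
  have hdeg : (pderiv j (pderiv k q)).totalDegree ≤ 1 := by
    have h₁ := totalDegree_pderiv_le q k
    have h₂ := totalDegree_pderiv_le (pderiv k q) j
    omega
  exact eval_eq_of_totalDegree_le_one hdeg x

lemma MvPolynomial.pderiv_comm {d : ℕ} (i j : Fin d) (p : MvPolynomial (Fin d) ℝ) :
    pderiv i (pderiv j p) = pderiv j (pderiv i p) := by
  have h : ⁅pderiv i, pderiv j⁆ =
      (0 : Derivation ℝ (MvPolynomial (Fin d) ℝ) (MvPolynomial (Fin d) ℝ)) :=
    derivation_ext fun k => by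
      rw [Derivation.commutator_apply]
      simp [pderiv_X, Pi.single_apply, apply_ite]
  rw [← sub_eq_zero, ← Derivation.commutator_apply, h, Derivation.zero_apply]

lemma hessField_eq_zero_of_mem_kerXTX {d : ℕ} {q : MvPolynomial (Fin d) ℝ}
    (hq : q.totalDegree ≤ 3) (h : hessField d q ∈ kerXTX d) : hessField d q = 0 := by
  rw [kerXTX_eq_map] at h
  obtain ⟨B, ⟨-, hB⟩, hBq⟩ := h
  have hess_zero : ∀ j k, hessField d q 0 j k = 0 := fun j k => by
    rw [← hBq, linearField_zero]
  have third : ∀ i j k, B i j k = eval 0 (pderiv i (pderiv j (pderiv k q))) := fun i j k => by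
    rw [← linearField_single B, hBq, hessField_eq_of_totalDegree_le_three hq, hess_zero,
      linearField_single, zero_add]
  have hB0 : B = 0 := by
    ext i j k
    have h₁ : B j k i = B i j k := by
      simp only [third]
      rw [pderiv_comm k i, pderiv_comm j i]
    have h₂ : B k i j = B i j k := by
      simp only [third]
      rw [pderiv_comm k i, pderiv_comm k j]
    simp only [Pi.zero_apply]
    linarith [hB i j k]
  rw [← hBq, hB0, map_zero]

lemma hessField_sub {d : ℕ} (p q : MvPolynomial (Fin d) ℝ) :
    hessField d (p - q) = hessField d p - hessField d q := by
  ext x j k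
  simp [hessField]

lemma exists_hessField_eq {d : ℕ} {A : Fin d → Fin d → ℝ} {T : Fin d → Fin d → Fin d → ℝ}
    (hA : ∀ j k, A j k = A k j) (hT : ∀ i j k, T i j k = T i k j)
    (hT' : ∀ i j k, T i j k = T j k i) :
    ∃ q : MvPolynomial (Fin d) ℝ, q.totalDegree ≤ 3 ∧
      ∀ x j k, hessField d q x j k = A j k + linearField d T x j k := by
  refine ⟨∑ a, ∑ b, C (A a b / 2) * (X a * X b) +
    ∑ a, ∑ b, ∑ c, C (T a b c / 6) * (X a * X b * X c), ?_, fun x j k => ?_⟩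
  · have hX : ∀ a : Fin d, (X a : MvPolynomial (Fin d) ℝ).totalDegree ≤ 1 := fun a =>
      (totalDegree_X a).le
    have hmul : ∀ {p q : MvPolynomial (Fin d) ℝ} {m n : ℕ}, p.totalDegree ≤ m →
        q.totalDegree ≤ n → (p * q).totalDegree ≤ m + n := fun hp hq =>
      (totalDegree_mul _ _).trans (add_le_add hp hq)
    have hC : ∀ (c : ℝ) (p : MvPolynomial (Fin d) ℝ), (C c * p).totalDegree ≤ p.totalDegree :=
      fun c p => by simpa using totalDegree_mul (C c) p
    refine (totalDegree_add _ _).trans (max_le ?_ ?_)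
    · refine totalDegree_finsetSum_le fun a _ => totalDegree_finsetSum_le fun b _ => ?_
      exact ((hC _ _).trans (hmul (hX a) (hX b))).trans (by norm_num)
    · refine totalDegree_finsetSum_le fun a _ => totalDegree_finsetSum_le fun b _ =>
        totalDegree_finsetSum_le fun c _ => ?_
      exact (hC _ _).trans (hmul (hmul (hX a) (hX b)) (hX c))
  · have hlin : linearField d T x j k = ∑ i, x i * T i j k := rfl
    have hjk : ∀ i, T j k i = T i j k := fun i => (hT' i j k).symm
    have hji : ∀ i, T j i k = T i j k := fun i => (hT j i k).trans (hjk i)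
    have hik : ∀ i, T i k j = T i j k := fun i => hT i k j
    have hki : ∀ i, T k i j = T i j k := fun i => hT' k i j
    have hkj : ∀ i, T k j i = T i j k := fun i => (hT k j i).trans (hki i)
    have hX : ∀ a b : Fin d, pderiv a (X b : MvPolynomial (Fin d) ℝ) =
        C (if b = a then 1 else 0) := fun a b => by
      rw [pderiv_X, Pi.single_apply, apply_ite C, C_1, C_0]
    have quad : ∀ (c : ℝ) (a b : Fin d), eval x (pderiv j (pderiv k (C c * (X a * X b)))) =
        c * ((if a = k then 1 else 0) * (if b = j then 1 else 0)) +
        c * ((if a = j then 1 else 0) * (if b = k then 1 else 0)) := fun c a b => by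
      simp only [Derivation.leibniz, hX, pderiv_C, smul_eq_mul, map_add, map_mul, eval_C,
        map_zero, mul_zero, add_zero]
      ring
    have cubic : ∀ (r : ℝ) (a b c : Fin d),
        eval x (pderiv j (pderiv k (C r * (X a * X b * X c)))) =
        r * ((if a = k then 1 else 0) * (if b = j then 1 else 0) * x c) +
        r * ((if a = j then 1 else 0) * (if b = k then 1 else 0) * x c) +
        r * ((if a = k then 1 else 0) * (if c = j then 1 else 0) * x b) +
        r * ((if a = j then 1 else 0) * (if c = k then 1 else 0) * x b) +
        r * ((if b = k then 1 else 0) * (if c = j then 1 else 0) * x a) +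
        r * ((if b = j then 1 else 0) * (if c = k then 1 else 0) * x a) := fun r a b c => by
      simp only [Derivation.leibniz, hX, pderiv_C, smul_eq_mul, map_add, map_mul, eval_C, eval_X,
        map_zero, mul_zero, add_zero]
      ring
    simp only [hessField, Matrix.of_apply, map_add, map_sum, quad, cubic,
      Finset.sum_add_distrib, mul_ite, ite_mul, mul_one, one_mul, mul_zero, zero_mul,
      Finset.sum_ite_irrel, Finset.sum_const_zero, Finset.sum_ite_eq', Finset.mem_univ, if_true,
      hlin, hA k j, hjk, hji, hik, hki, hkj]
    rw [add_halves]
    simp only [← Finset.sum_add_distrib]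
    congr 1
    exact Finset.sum_congr rfl fun i _ => by ring

lemma card_sigma_Ici_Ioi (d : ℕ) :
    Fintype.card (Σ a : Fin d, Set.Ici a × Set.Ioi a) = 2 * Nat.choose (d + 1) 3 := by
  have hsum : ∀ n : ℕ, ∑ m ∈ Finset.range n, (m + 1) * m = 2 * Nat.choose (n + 1) 3 := by
    intro n
    induction n with
    | zero => rfl
    | succ n ih =>
      rw [Finset.sum_range_succ, ih, Nat.choose_succ_succ' (n + 1) 2, mul_add, add_comm,
        Nat.add_right_cancel_iff, mul_comm 2, ← Nat.add_one_mul_choose_eq n 1, Nat.choose_one_right]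
  rw [← hsum, ← Finset.sum_range_reflect, ← Fin.sum_univ_eq_sum_range
    (fun a => (d - 1 - a + 1) * (d - 1 - a))]
  simp only [Fintype.card_sigma, Fintype.card_prod]
  refine Finset.sum_congr rfl fun a _ => ?_
  have := a.isLt
  simp
  omega

lemma finrank_cyclicKer (d : ℕ) :
    Module.finrank ℝ (cyclicKer d) = 2 * Nat.choose (d + 1) 3 := by
  let F : cyclicKer d →ₗ[ℝ] ((Σ a : Fin d, Set.Ici a × Set.Ioi a) → ℝ) :=
    { toFun := fun B s => B.1 s.2.2 s.1 s.2.1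
      map_add' := fun _ _ => rfl
      map_smul' := fun _ _ => rfl }
  have hF : Function.Bijective F := by
    constructor
    · rw [← LinearMap.ker_eq_bot, LinearMap.ker_eq_bot']
      rintro ⟨B, hB, hB'⟩ h
      have key : ∀ a b c, a ≤ b → a < c → B c a b = 0 := fun a b c hab hac =>
        congrFun h ⟨a, ⟨b, hab⟩, ⟨c, hac⟩⟩
      have zero_of_le : ∀ i j k, j ≤ k → B i j k = 0 := by
        intro i j k hjk
        rcases lt_or_ge j i with hji | hij
        · exact key j k i hjk hji
        · have hsum := hB' i j k
          rcases hij.lt_or_eq with hij | rfl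
          · rw [hB j k i, key i k j (hij.le.trans hjk) hij, key i j k hij.le (hij.trans_le hjk)]
              at hsum
            linarith
          · rcases hjk.lt_or_eq with hjk | rfl
            · rw [hB i k i, key i i k le_rfl hjk] at hsum
              linarith
            · linarith
      ext i j k
      rcases le_total j k with hjk | hjk
      · exact zero_of_le i j k hjk
      · exact (hB i j k).trans (zero_of_le i k j hjk)
    · intro g
      let G : Fin d → Fin d → Fin d → ℝ := fun c a b =>
        if h : a ≤ b ∧ a < c then g ⟨a, ⟨b, h.1⟩, ⟨c, h.2⟩⟩ else 0
      let B : Fin d → Fin d → Fin d → ℝ := fun i j k =>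
        if min j k < i then G i (min j k) (max j k)
        else if i < min j k then -G (min j k) i (max j k) - G (max j k) i (min j k)
        else -G (max j k) i i / 2
      have hG : ∀ i, G i i i = 0 := fun i => dif_neg fun h => lt_irrefl i h.2
      have hB : B ∈ cyclicKer d := by
        have hsymm : ∀ i j k, B i j k = B i k j := fun i j k => by
          simp only [B, min_comm, max_comm]
        have hsorted : ∀ i j k, i ≤ j → j ≤ k → B i j k + B j k i + B k i j = 0 := by
          intro i j k hij hjk
          have hik := hij.trans hjk
          simp only [B, min_eq_left hjk, max_eq_right hjk, min_eq_right hik, max_eq_left hik,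
            min_eq_left hij, max_eq_right hij]
          rcases hij.lt_or_eq with hij | rfl
          · simp only [hij, hij.not_gt, hij.trans_le hjk, if_true, if_false]
            ring
          · rcases hjk.lt_or_eq with hjk | rfl
            · simp [hjk]
            · simp [hG]
        refine ⟨hsymm, fun i j k => ?_⟩
        have h₁ := hsymm i j k
        have h₂ := hsymm j k i
        have h₃ := hsymm k i j
        rcases le_total i j with hij | hij <;> rcases le_total j k with hjk | hjk
        · exact hsorted i j k hij hjk
        · rcases le_total i k with hik | hik
          · linarith [hsorted i k j hik hjk]
          · linarith [hsorted k i j hik hij]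
        · rcases le_total i k with hik | hik
          · linarith [hsorted j i k hij hik]
          · linarith [hsorted j k i hjk hik]
        · linarith [hsorted k j i hjk hij]
      refine ⟨⟨B, hB⟩, ?_⟩
      ext ⟨a, ⟨b, hab⟩, ⟨c, hac⟩⟩
      have hac' : a < c := hac
      have hab' : a ≤ b := hab
      have hBG : B c a b = G c a b := by
        simp only [B, min_eq_left hab', max_eq_right hab', if_pos hac']
      refine hBG.trans ?_
      exact dif_pos (And.intro hab' hac')
  rw [(LinearEquiv.ofBijective F hF).finrank_eq, Module.finrank_fintype_fun_eq_card,
    card_sigma_Ici_Ioi]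

/-- `P₁(ℝ^d; S)` decomposes as the direct sum of Hessians of cubic polynomials and
the kernel of `τ ↦ xᵀ τ(x) x`; consequently that kernel has dimension `2·C(d+1,3)`. -/
theorem P1Sym_direct_sum_hessian_ker (d : ℕ) (hd : 1 ≤ d) :
    (∀ τ ∈ P1Sym d, ∃! p : MatField d × MatField d,
        (∃ q : MvPolynomial (Fin d) ℝ, q.totalDegree ≤ 3 ∧ p.1 = hessField d q) ∧
        p.2 ∈ kerXTX d ∧ τ = p.1 + p.2) ∧
    Module.finrank ℝ (Submodule.span ℝ (kerXTX d)) = 2 * Nat.choose (d + 1) 3 := by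
  refine ⟨fun τ hτ => ?_, ?_⟩
  · obtain ⟨A, B, hA, hB, hAB⟩ := mem_P1Sym_iff.1 hτ
    let T : Fin d → Fin d → Fin d → ℝ := fun i j k => (B i j k + B j k i + B k i j) / 3
    have hT : ∀ i j k, T i j k = T i k j := fun i j k => by
      simp only [T, hB i j k, hB j k i, hB k i j]
      ring
    have hT' : ∀ i j k, T i j k = T j k i := fun i j k => by
      simp only [T]
      ring
    obtain ⟨q, hq, hqT⟩ := exists_hessField_eq hA hT hT'
    refine existsUnique_of_exists_of_unique
      ⟨(hessField d q, linearField d (B - T)), ⟨q, hq, rfl⟩, ?_, ?_⟩ ?_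
    · rw [kerXTX_eq_map]
      refine ⟨B - T, ⟨fun i j k => ?_, fun i j k => ?_⟩, rfl⟩
      · simp only [Pi.sub_apply, hB i j k, hT i j k]
      · simp only [Pi.sub_apply, T]
        ring
    · ext x j k
      simp [hAB, hqT]
    · rintro ⟨_, κ₁⟩ ⟨_, κ₂⟩ ⟨⟨q₁, hq₁, rfl⟩, hκ₁, h₁⟩ ⟨⟨q₂, hq₂, rfl⟩, hκ₂, h₂⟩
      simp only at hκ₁ hκ₂ h₁ h₂
      have hsum : hessField d q₁ + κ₁ = hessField d q₂ + κ₂ := h₁.symm.trans h₂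
      have hdiff : hessField d (q₁ - q₂) = κ₂ - κ₁ := by
        rw [hessField_sub, sub_eq_sub_iff_add_eq_add, hsum, add_comm]
      have hzero : hessField d (q₁ - q₂) = 0 := by
        refine hessField_eq_zero_of_mem_kerXTX
          ((totalDegree_sub _ _).trans (max_le hq₁ hq₂)) ?_
        rw [kerXTX_eq_map] at hκ₁ hκ₂ ⊢
        rw [hdiff]
        exact Submodule.sub_mem _ hκ₂ hκ₁
      have hess_eq : hessField d q₁ = hessField d q₂ := by
        rwa [hessField_sub, sub_eq_zero] at hzero
      rw [hess_eq, add_right_inj] at hsum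
      rw [hess_eq, hsum]
  · rw [kerXTX_eq_map, Submodule.span_eq, ← finrank_cyclicKer d]
    exact (Submodule.equivMapOfInjective _ (linearField_injective d) _).finrank_eq.symm
end

section
/- For any twice differentiable vector field v : R³ → R³, the row-wise curl of the matrix field x ⊗ v satisfies sym(curl(x ⊗ v)) = sym(x ⊗ curl v), where curl is applied row-wise to the matrix field (x⊗v)_{ij} = xᵢ vⱼ. -/
/-- Partial derivative of a scalar function on `ℝ³` in the `j`-th coordinate direction. -/
noncomputable def pd3 (j : Fin 3) (f : (Fin 3 → ℝ) → ℝ) (x : Fin 3 → ℝ) : ℝ :=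
  fderiv ℝ f x (Pi.single j 1)

/-- The `i`-th component of the curl of a vector field `w` on `ℝ³`. -/
noncomputable def curl3 (w : (Fin 3 → ℝ) → (Fin 3 → ℝ)) (i : Fin 3)
    (x : Fin 3 → ℝ) : ℝ :=
  pd3 (i + 1) (fun y => w y (i + 2)) x - pd3 (i + 2) (fun y => w y (i + 1)) x

/-- The `(i,j)` entry of the row-wise curl of the matrix field `x ⊗ v`
(row `i` is `y ↦ yᵢ v(y)`). -/
noncomputable def curlRowXV (v : (Fin 3 → ℝ) → (Fin 3 → ℝ)) (i j : Fin 3)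
    (x : Fin 3 → ℝ) : ℝ :=
  curl3 (fun y => fun k => y i * v y k) j x

/-- Product rule for the partial derivatives of a coordinate times a scalar function. -/
theorem pd3_coord_mul (i j : Fin 3) {f : (Fin 3 → ℝ) → ℝ} {x : Fin 3 → ℝ}
    (hf : DifferentiableAt ℝ f x) :
    pd3 j (fun y => y i * f y) x = x i * pd3 j f x + (if i = j then 1 else 0) * f x := by
  have hc : HasFDerivAt (fun y : Fin 3 → ℝ => y i)
      (ContinuousLinearMap.proj (R := ℝ) (φ := fun _ : Fin 3 => ℝ) i) x :=
    hasFDerivAt_apply i x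
  rw [pd3, (hc.fun_mul hf.hasFDerivAt).fderiv]
  simp [pd3, Pi.single_apply, mul_comm]

/-- The curl of `y ↦ yᵢ v(y)` is `xᵢ curl v + eᵢ × v`. -/
theorem curlRowXV_eq {v : (Fin 3 → ℝ) → (Fin 3 → ℝ)} {x : Fin 3 → ℝ}
    (hv : DifferentiableAt ℝ v x) (i j : Fin 3) :
    curlRowXV v i j x = x i * curl3 v j x
      + ((if i = j + 1 then 1 else 0) * v x (j + 2)
        - (if i = j + 2 then 1 else 0) * v x (j + 1)) := by
  have hd : ∀ k, DifferentiableAt ℝ (fun y => v y k) x := differentiableAt_pi.1 hv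
  simp only [curlRowXV, curl3, pd3_coord_mul _ _ (hd _)]
  ring

/-- For any twice differentiable vector field `v : ℝ³ → ℝ³`,
`sym(curl(x ⊗ v)) = sym(x ⊗ curl v)`. -/
theorem sym_curl_x_tensor_v (v : (Fin 3 → ℝ) → (Fin 3 → ℝ)) (hv : ContDiff ℝ 2 v)
    (x : Fin 3 → ℝ) (i j : Fin 3) :
    (curlRowXV v i j x + curlRowXV v j i x) / 2
      = (x i * curl3 v j x + x j * curl3 v i x) / 2 := by
  have hd : DifferentiableAt ℝ v x := hv.differentiable (by norm_num) x
  rw [curlRowXV_eq hd, curlRowXV_eq hd]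
  fin_cases i <;> fin_cases j <;> simp <;> ring
end
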